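/- arXiv:2507.08483 — 3 statements merged into one kernel-verified Lean document; each statement's English description precedes it below -/
import Mathlib

section
/- Let G be a finite simple graph on n vertices and let x be a vertex of G of degree n − 1 (adjacent to all other vertices). Then G is word-representable if and only if the graph H = G \ {x}, obtained by removing x and all edges incident to it, is a comparability graph. -/
/-- Two distinct letters `x` and `y` alternate in a word `w` if the subsequence of `w`
obtained by deleting all letters other than `x` and `y` has no two equal consecutive
letters (i.e. it is of the form `xyxy...` or `yxyx...`). -/
def Alternates {V : Type*} [DecidableEq V] (w : List V) (x y : V) : Prop :=
  (w.filter fun z => decide (z = x ∨ z = y)).Chain' (· ≠ ·)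

/-- `w` is a word representing the graph `G`: every vertex occurs in `w`, and two distinct
vertices alternate in `w` iff they are adjacent in `G`. -/
def WordRepresents {V : Type*} [DecidableEq V] (G : SimpleGraph V) (w : List V) : Prop :=
  (∀ v : V, v ∈ w) ∧ ∀ x y : V, x ≠ y → (Alternates w x y ↔ G.Adj x y)

/-- A graph is word-representable if some word represents it. -/
def WordRepresentable {V : Type*} [DecidableEq V] (G : SimpleGraph V) : Prop :=
  ∃ w : List V, WordRepresents G w
/-- `r` is an orientation of `G`: an irreflexive, asymmetric relation (exactly one direction
per edge) whose symmetric closure is the adjacency relation of `G`. -/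
structure IsOrientation {V : Type*} (G : SimpleGraph V) (r : V → V → Prop) : Prop where
  irrefl : ∀ v, ¬ r v v
  asymm : ∀ u v, r u v → ¬ r v u
  adj_iff : ∀ u v, G.Adj u v ↔ (r u v ∨ r v u)

/-- A relation is acyclic if it has no directed cycle. -/
def RelAcyclic {V : Type*} (r : V → V → Prop) : Prop :=
  ∀ v, ¬ Relation.TransGen r v v

/-- `r` is a semi-transitive orientation of `G`: it is an acyclic orientation and for any
directed path `p 0 → p 1 → ⋯ → p t` (with `t ≥ 1` edges, i.e. at least two vertices),
either there is no edge between the endpoints, or `p i → p j` for all `i < j`. -/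
def IsSemiTransitiveOrientation {V : Type*} (G : SimpleGraph V) (r : V → V → Prop) : Prop :=
  IsOrientation G r ∧ RelAcyclic r ∧
    ∀ (t : ℕ) (p : Fin (t + 1) → V), 1 ≤ t →
      (∀ i : Fin t, r (p i.castSucc) (p i.succ)) →
      (¬ G.Adj (p 0) (p (Fin.last t)) ∨ ∀ i j : Fin (t + 1), i < j → r (p i) (p j))
/-- `r` is a transitive orientation of `G`. -/
def IsTransitiveOrientation {V : Type*} (G : SimpleGraph V) (r : V → V → Prop) : Prop :=
  IsOrientation G r ∧ ∀ u v z, r u v → r v z → r u z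

/-- A graph is a comparability graph if it admits a transitive orientation. -/
def IsComparabilityGraph {V : Type*} (G : SimpleGraph V) : Prop :=
  ∃ r : V → V → Prop, IsTransitiveOrientation G r

/-- The letter `y` leads `z` in `w` if they alternate and the first occurrence of either letter is
`y`, expressed by comparing the numbers of occurrences in every prefix. -/
def Leads {V : Type*} [DecidableEq V] (w : List V) (y z : V) : Prop :=
  ∀ p, p <+: w → p.count z ≤ p.count y ∧ p.count y ≤ p.count z + 1

section

variable {V : Type*} [DecidableEq V]

theorem leads_cons (a : V) (w : List V) {y z : V} (hyz : y ≠ z) :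
    Leads (a :: w) y z ↔ a ≠ z ∧ if a = y then Leads w z y else Leads w y z := by
  constructor
  · intro h
    have haz : a ≠ z := by
      rintro rfl
      simpa [hyz.symm] using (h [a] (by simp)).1
    refine ⟨haz, ?_⟩
    split_ifs with hay
    all_goals
      intro p hp
      have := h (a :: p) (by simpa using hp)
      simp only [List.count_cons, beq_iff_eq, haz, hay, hyz, if_true, if_false] at this
      omega
  · rintro ⟨haz, h⟩ p hp
    cases p with
    | nil => simp
    | cons b p =>
      obtain ⟨rfl, hpw⟩ := List.cons_prefix_cons.1 hp
      split_ifs at h with hay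
      all_goals
        have := h p hpw
        simp only [List.count_cons, beq_iff_eq, haz, hay, hyz, if_true, if_false]
        omega

theorem leads_iff_isChain (w : List V) {y z : V} (hyz : y ≠ z) :
    Leads w y z ↔ (z :: w.filter fun u => decide (u = y ∨ u = z)).IsChain (· ≠ ·) := by
  induction w generalizing y z with
  | nil => simp [Leads]
  | cons a w ih =>
    rw [leads_cons a w hyz]
    by_cases hay : a = y
    · subst hay
      simp [hyz, hyz.symm, ih hyz.symm, or_comm]
    · by_cases haz : a = z
      · subst haz
        simp
      · simp [hay, haz, ih hyz]

theorem alternates_iff_leads_or_leads (w : List V) {y z : V} (hyz : y ≠ z) :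
    Alternates w y z ↔ Leads w y z ∨ Leads w z y := by
  rw [leads_iff_isChain w hyz, leads_iff_isChain w hyz.symm]
  change List.IsChain (· ≠ ·) _ ↔ _
  simp only [or_comm (a := _ = z)]
  have hmem : ∀ u ∈ w.filter fun u => decide (u = y ∨ u = z), u = y ∨ u = z := by
    simp
  generalize (w.filter fun u => decide (u = y ∨ u = z)) = f at hmem
  cases f with
  | nil => simp
  | cons a f =>
    rcases hmem a (by simp) with rfl | rfl
    · simp [hyz.symm]
    · simp [hyz]

theorem eq_of_count_prefix_eq {w : List V} {y z : V} (hy : y ∈ w)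
    (h : ∀ p, p <+: w → p.count y = p.count z) : y = z := by
  obtain ⟨p, q, rfl⟩ := List.append_of_mem hy
  have h₁ := h p (by simp)
  have h₂ := h (p ++ [y]) (by simp)
  by_contra hyz
  simp [hyz] at h₂
  omega

theorem Leads.antisymm {w : List V} {y z : V} (hy : y ∈ w) (h : Leads w y z) (h' : Leads w z y) :
    y = z :=
  eq_of_count_prefix_eq hy fun p hp => le_antisymm (h' p hp).1 (h p hp).1

theorem leads_append {u v : List V} {y z : V} (h : u.count y = u.count z) :
    Leads (u ++ v) y z ↔ Leads u y z ∧ Leads v y z := by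
  constructor
  · refine fun hl => ⟨fun p hp => hl p (hp.trans (List.prefix_append u v)), fun p hp => ?_⟩
    have := hl (u ++ p) ((List.prefix_append_right_inj u).2 hp)
    simp only [List.count_append] at this
    omega
  · rintro ⟨hu, hv⟩ p hp
    rcases List.prefix_or_prefix_of_prefix hp (List.prefix_append u v) with hpu | ⟨q, rfl⟩
    · exact hu p hpu
    · have := hv q ((List.prefix_append_right_inj u).1 hp)
      simp only [List.count_append]
      omega

theorem leads_flatMap {ι : Type*} (l : List ι) (f : ι → List V) {y z : V}
    (h : ∀ i, (f i).count y = (f i).count z) :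
    Leads (l.flatMap f) y z ↔ ∀ i ∈ l, Leads (f i) y z := by
  induction l with
  | nil => simp [Leads]
  | cons i l ih => simp [List.flatMap_cons, leads_append (h i), ih]

theorem leads_of_pairwise {s : V → V → Prop} [Std.Antisymm s] {w : List V} (hw : w.Pairwise s)
    (hnd : w.Nodup) {y z : V} (hy : y ∈ w) (hyz : s y z) : Leads w y z := by
  rintro p ⟨q, rfl⟩
  have hp : p.Nodup := hnd.of_append_left
  refine ⟨?_, (List.nodup_iff_count_le_one.1 hp y).trans (by omega)⟩
  by_cases hz : z ∈ p
  · by_cases hyp : y ∈ p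
    · rw [List.count_eq_one_of_mem hp hz, List.count_eq_one_of_mem hp hyp]
    · have hyq : y ∈ q := (List.mem_append.1 hy).resolve_left hyp
      have := (List.pairwise_append.1 hw).2.2 z hz y hyq
      exact absurd (antisymm_of s hyz this ▸ hz) hyp
  · simp [List.count_eq_zero_of_not_mem hz]

/-- Every partial order has a linear extension placing `a` below `b`, unless `b < a`. -/
theorem exists_linearExtension {α : Type*} (r : α → α → Prop) [IsPartialOrder α r] (a b : α) :
    ∃ s : α → α → Prop, IsLinearOrder α s ∧ r ≤ s ∧ (¬ r b a → s a b) := by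
  by_cases hba : r b a
  · obtain ⟨s, hs, hrs⟩ := extend_partialOrder r
    exact ⟨s, hs, hrs, fun h => absurd hba h⟩
  · let t : α → α → Prop := fun u v => r u v ∨ (r u a ∧ r b v)
    have ht : IsPartialOrder α t :=
      { refl := fun u => Or.inl (refl_of r u)
        trans := by
          rintro u v w (h₁ | ⟨h₁, h₂⟩) (h₃ | ⟨h₃, h₄⟩)
          · exact Or.inl (trans_of r h₁ h₃)
          · exact Or.inr ⟨trans_of r h₁ h₃, h₄⟩
          · exact Or.inr ⟨h₁, trans_of r h₂ h₃⟩
          · exact absurd (trans_of r h₂ h₃) hba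
        antisymm := by
          rintro u v (h₁ | ⟨h₁, h₂⟩) (h₃ | ⟨h₃, h₄⟩)
          · exact antisymm_of r h₁ h₃
          · exact absurd (trans_of r h₄ (trans_of r h₁ h₃)) hba
          · exact absurd (trans_of r h₂ (trans_of r h₃ h₁)) hba
          · exact absurd (trans_of r h₂ h₃) hba }
    obtain ⟨s, hs, hts⟩ := extend_partialOrder t
    exact ⟨s, hs, fun u v h => hts u v (Or.inl h),
      fun _ => hts a b (Or.inr ⟨refl_of r a, refl_of r b⟩)⟩

/-- A transitive orientation has a topological sorting in which `a` leads `b`,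
unless `b` precedes `a`. -/
theorem exists_topologicalSort [Fintype V] {G : SimpleGraph V} {r : V → V → Prop}
    (hr : IsTransitiveOrientation G r) (a b : V) :
    ∃ w : List V, w.Nodup ∧ (∀ v, v ∈ w) ∧ (∀ y z, r y z → Leads w y z) ∧
      (a ≠ b → ¬ r b a → Leads w a b) := by
  have hle : IsPartialOrder V fun u v => u = v ∨ r u v :=
    { refl := fun u => Or.inl rfl
      trans := by
        rintro u v w (rfl | h₁) (rfl | h₂)
        · exact Or.inl rfl
        · exact Or.inr h₂
        · exact Or.inr h₁
        · exact Or.inr (hr.2 _ _ _ h₁ h₂)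
      antisymm := by
        rintro u v (h₁ | h₁) (h₂ | h₂)
        · exact h₁
        · exact h₁
        · exact h₂.symm
        · exact absurd h₂ (hr.1.asymm _ _ h₁) }
  obtain ⟨s, hs, hrs, hab⟩ := exists_linearExtension (fun u v => u = v ∨ r u v) a b
  classical
  have hw : (Finset.univ.sort s).Pairwise s := Finset.pairwise_sort _ _
  have hnd : (Finset.univ.sort s).Nodup := Finset.sort_nodup _ _
  have hmem : ∀ v, v ∈ Finset.univ.sort s := by simp
  refine ⟨Finset.univ.sort s, hnd, hmem, fun y z h => ?_, fun hne h => ?_⟩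
  · exact leads_of_pairwise hw hnd (hmem y) (hrs y z (Or.inr h))
  · exact leads_of_pairwise hw hnd (hmem a) (hab fun h' => h'.elim (fun e => hne e.symm) h)

theorem IsComparabilityGraph.wordRepresentable [Fintype V] [Nonempty V] {G : SimpleGraph V}
    (hG : IsComparabilityGraph G) : WordRepresentable G := by
  obtain ⟨r, hr⟩ := hG
  choose f hnd hmem hlead hab using exists_topologicalSort hr
  let w := (Finset.univ : Finset (V × V)).toList.flatMap fun i => f i.1 i.2
  have hw : ∀ y z, y ≠ z → (Leads w y z ↔ r y z) := by
    intro y z hyz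
    rw [leads_flatMap _ _ fun i => by
      rw [List.count_eq_one_of_mem (hnd _ _) (hmem _ _ y),
        List.count_eq_one_of_mem (hnd _ _) (hmem _ _ z)]]
    refine ⟨fun h => ?_, fun h i _ => hlead _ _ _ _ h⟩
    by_contra hn
    exact hyz ((h (z, y) (by simp)).antisymm (hmem _ _ y) (hab z y hyz.symm hn))
  refine ⟨w, fun v => ?_, fun y z hyz => ?_⟩
  · exact List.mem_flatMap.2 ⟨(v, v), by simp, hmem _ _ v⟩
  · rw [alternates_iff_leads_or_leads w hyz, hw y z hyz, hw z y hyz.symm, hr.1.adj_iff]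

/-- Adding a vertex adjacent to everything preserves being a comparability graph. -/
theorem IsComparabilityGraph.of_induce_ne {V : Type*} {G : SimpleGraph V} {x : V}
    (hx : ∀ y : V, y ≠ x → G.Adj x y) (h : IsComparabilityGraph (G.induce {y : V | y ≠ x})) :
    IsComparabilityGraph G := by
  obtain ⟨r, ho, htr⟩ := h
  refine ⟨fun u v => (u = x ∧ v ≠ x) ∨ ∃ (hu : u ≠ x) (hv : v ≠ x), r ⟨u, hu⟩ ⟨v, hv⟩,
    ⟨?_, ?_, ?_⟩, ?_⟩
  · rintro v (⟨h₁, h₂⟩ | ⟨_, _, h⟩)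
    · exact h₂ h₁
    · exact ho.irrefl _ h
  · rintro u v (⟨h₁, h₂⟩ | ⟨hu, hv, h⟩) (⟨h₃, h₄⟩ | ⟨hv', hu', h'⟩)
    · exact h₂ h₃
    · exact hu' h₁
    · exact hv h₃
    · exact ho.asymm _ _ h h'
  · intro u v
    by_cases hu : u = x
    · subst hu
      by_cases hv : v = u
      · simp [hv]
      · simp [hv, hx v hv]
    · by_cases hv : v = x
      · subst hv
        simp [hu, (hx u hu).symm]
      · simpa [hu, hv] using ho.adj_iff ⟨u, hu⟩ ⟨v, hv⟩
  · rintro u v z (⟨h₁, h₂⟩ | ⟨hu, hv, h⟩) (⟨h₃, h₄⟩ | ⟨hv', hz, h'⟩)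
    · exact absurd h₃ h₂
    · exact Or.inl ⟨h₁, hz⟩
    · exact absurd h₃ hv
    · exact Or.inr ⟨hu, hz, htr _ _ _ h h'⟩

/-- The number of occurrences of `y` in `p` minus that of `x`, shifted by one if `x` leads `y` in
`w`. If `x` and `y` alternate in `w`, then on prefixes of `w` it is `0` or `1`. -/
noncomputable def excess (w : List V) (x y : V) (p : List V) : ℤ :=
  open Classical in p.count y - p.count x + if Leads w x y then 1 else 0

theorem excess_mem_Icc {w : List V} {x y : V} (hxy : x ≠ y) (h : Alternates w x y) {p : List V}
    (hp : p <+: w) : excess w x y p ∈ Set.Icc 0 1 := by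
  rw [alternates_iff_leads_or_leads w hxy] at h
  rw [excess, Set.mem_Icc]
  split_ifs with hl
  · have := hl p hp
    omega
  · have := h.resolve_left hl p hp
    omega

/-- Two letters that both alternate with `x` alternate with each other iff their excesses over `x`
are comparable. -/
theorem alternates_iff_excess_le {w : List V} {x y z : V} (hxy : x ≠ y) (hxz : x ≠ z)
    (hyz : y ≠ z) (hy : Alternates w x y) (hz : Alternates w x z) :
    Alternates w y z ↔ (∀ p, p <+: w → excess w x z p ≤ excess w x y p) ∨
      ∀ p, p <+: w → excess w x y p ≤ excess w x z p := by
  have hey := fun p (hp : p <+: w) => excess_mem_Icc hxy hy hp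
  have hez := fun p (hp : p <+: w) => excess_mem_Icc hxz hz hp
  rw [alternates_iff_leads_or_leads w hyz]
  simp only [excess, Set.mem_Icc] at hey hez ⊢
  classical
  generalize (if Leads w x y then (1 : ℤ) else 0) = b at hey ⊢
  generalize (if Leads w x z then (1 : ℤ) else 0) = c at hez ⊢
  have hb := hey [] (by simp)
  have hc := hez [] (by simp)
  simp only [List.count_nil] at hb hc
  constructor
  · intro h
    rcases lt_trichotomy b c with hbc | rfl | hbc
    · refine Or.inr fun p hp => ?_
      have := hey p hp
      have := hez p hp
      rcases h with h | h <;> have := h p hp <;> omega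
    · refine h.imp (fun h p hp => ?_) fun h p hp => ?_ <;> have := h p hp <;> omega
    · refine Or.inl fun p hp => ?_
      have := hey p hp
      have := hez p hp
      rcases h with h | h <;> have := h p hp <;> omega
  · rintro (h | h)
    all_goals
      have h₀ := h [] (by simp)
      simp only [List.count_nil] at h₀
      rcases lt_trichotomy b c with hbc | rfl | hbc
    · omega
    · refine Or.inl fun p hp => ?_
      have := h p hp
      have := hey p hp
      have := hez p hp
      omega
    · refine Or.inr fun p hp => ?_
      have := h p hp
      have := hey p hp
      have := hez p hp
      omega
    · refine Or.inl fun p hp => ?_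
      have := h p hp
      have := hey p hp
      have := hez p hp
      omega
    · refine Or.inr fun p hp => ?_
      have := h p hp
      have := hey p hp
      have := hez p hp
      omega
    · omega

theorem WordRepresentable.isComparabilityGraph_induce {G : SimpleGraph V} {x : V}
    (hx : ∀ y : V, y ≠ x → G.Adj x y) (h : WordRepresentable G) :
    IsComparabilityGraph (G.induce {y : V | y ≠ x}) := by
  obtain ⟨w, hmem, hw⟩ := h
  have halt : ∀ y, y ≠ x → Alternates w x y := fun y hy => (hw x y hy.symm).2 (hx y hy)
  have heq : ∀ y z, (∀ p, p <+: w → excess w x z p ≤ excess w x y p) →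
      (∀ p, p <+: w → excess w x y p ≤ excess w x z p) → y = z := by
    intro y z h₁ h₂
    refine eq_of_count_prefix_eq (hmem y) fun p hp => ?_
    have h₃ := le_antisymm (h₁ p hp) (h₂ p hp)
    have h₄ := le_antisymm (h₁ [] (by simp)) (h₂ [] (by simp))
    simp only [excess, List.count_nil] at h₃ h₄
    omega
  refine ⟨fun y z => y ≠ z ∧ ∀ p, p <+: w → excess w x z p ≤ excess w x y p, ⟨?_, ?_, ?_⟩, ?_⟩
  · exact fun v h => h.1 rfl
  · exact fun u v h h' => h.1 (Subtype.ext (heq _ _ h.2 h'.2))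
  · rintro ⟨u, hu⟩ ⟨v, hv⟩
    by_cases huv : u = v
    · subst huv
      simp
    · rw [SimpleGraph.comap_adj]
      have := alternates_iff_excess_le (Ne.symm hu) (Ne.symm hv) huv (halt u hu) (halt v hv)
      simpa [← hw u v huv, huv, Ne.symm huv] using this
  · rintro u v z ⟨h₁, h₂⟩ ⟨h₃, h₄⟩
    have huz : ∀ p, p <+: w → excess w x z p ≤ excess w x u p :=
      fun p hp => (h₄ p hp).trans (h₂ p hp)
    refine ⟨?_, huz⟩
    rintro rfl
    exact h₁ (Subtype.ext (heq _ _ h₂ h₄))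

end

/-- If `x` is adjacent to all other vertices of `G`, then `G` is word-representable
iff `G \ {x}` is a comparability graph. -/
theorem stmt1 {V : Type*} [Fintype V] [DecidableEq V] (G : SimpleGraph V) (x : V)
    (hx : ∀ y : V, y ≠ x → G.Adj x y) :
    WordRepresentable G ↔ IsComparabilityGraph (G.induce {y : V | y ≠ x}) := by
  have : Nonempty V := ⟨x⟩
  exact ⟨fun h => h.isComparabilityGraph_induce hx, fun h => (h.of_induce_ne hx).wordRepresentable⟩
end

section
/- Let S be a finite split graph with vertex partition into a clique K and an independent set E, and let S' be the graph obtained from S by duplicating a vertex v of S: a new vertex v' is added whose neighborhood is exactly the neighborhood of v (with v' non-adjacent to v if v ∈ E, and v' adjacent to v if v ∈ K, so that S' is again a split graph). Then S is word-representable if and only if S' is word-representable. -/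
/-- Deleting and injectively renaming letters does not affect whether two surviving letters
alternate. -/
lemma alternates_filterMap {α β : Type*} [DecidableEq α] [DecidableEq β] {e : α → Option β}
    (he : ∀ a b c, e a = some c → e b = some c → a = b) {w : List α} {a b : α} {x y : β}
    (ha : e a = some x) (hb : e b = some y) :
    Alternates (w.filterMap e) x y ↔ Alternates w a b := by
  have key : (w.filter fun z => decide (z = a ∨ z = b)).map e =
      ((w.filterMap e).filter fun z => decide (z = x ∨ z = y)).map some := by
    induction w with
    | nil => simp
    | cons c w ih =>
      rcases hc : e c with _ | d
      · have h : ¬ (c = a ∨ c = b) := by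
          rintro (rfl | rfl) <;> simp_all
        simpa [List.filterMap_cons, hc, h] using ih
      · have h : (c = a ∨ c = b) ↔ (d = x ∨ d = y) := by grind
        by_cases hd : d = x ∨ d = y
        · simpa [List.filterMap_cons, hc, h, hd] using ih
        · simpa [List.filterMap_cons, hc, h, hd] using ih
  have hiff := congrArg (List.IsChain (· ≠ ·)) key
  rw [List.isChain_map, List.isChain_map] at hiff
  have hsome : List.IsChain (fun p q : β => some p ≠ some q)
      ((w.filterMap e).filter fun z => decide (z = x ∨ z = y)) ↔
      Alternates (w.filterMap e) x y := List.IsChain.iff (by simp)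
  rw [← hsome, ← hiff]
  refine ⟨fun h => List.IsChain.imp (fun p q hpq hpq' => hpq (congrArg e hpq')) h,
    fun h => List.IsChain.imp_of_mem_imp (fun p q hp hq hpq => ?_) h⟩
  simp only [List.mem_filter, decide_eq_true_eq] at hp hq
  grind

lemma alternates_comm {α : Type*} [DecidableEq α] {w : List α} {x y : α} :
    Alternates w x y ↔ Alternates w y x := by
  simp only [Alternates, or_comm]

lemma filter_dedup {α : Type*} [DecidableEq α] (p : α → Bool) (l : List α) :
    l.dedup.filter p = (l.filter p).dedup := by
  induction l with
  | nil => simp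
  | cons a l ih =>
    by_cases ha : a ∈ l <;> by_cases hp : p a <;>
      simp [ha, hp, ih]

lemma dedup_append_pair {α : Type*} [DecidableEq α] {a b : α} (hab : a ≠ b) {l : List α}
    (hl : ∀ c ∈ l, c = a ∨ c = b) : (l ++ [a, b]).dedup = [a, b] := by
  induction l with
  | nil => simp [hab]
  | cons c l ih =>
    rw [List.cons_append, List.dedup_cons_of_mem (by have := hl c (by simp); grind)]
    exact ih fun d hd => hl d (List.mem_cons_of_mem _ hd)

/-- Appending to a word the permutation of its letters given by their last occurrences does not
change which letters alternate. -/
lemma alternates_append_dedup {α : Type*} [DecidableEq α] {w : List α} {x y : α} (hxy : x ≠ y)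
    (hx : x ∈ w) (hy : y ∈ w) : Alternates (w ++ w.dedup) x y ↔ Alternates w x y := by
  simp only [Alternates, List.filter_append, filter_dedup]
  set l := w.filter fun z => decide (z = x ∨ z = y) with hl
  have hmem : ∀ c ∈ l, c = x ∨ c = y := by simp [hl]
  have hxl : x ∈ l := by simp [hl, hx]
  have hyl : y ∈ l := by simp [hl, hy]
  clear_value l
  refine ⟨fun h => (List.isChain_append.1 h).1, fun h => ?_⟩
  obtain ⟨m, a, b, rfl⟩ : ∃ m a b, l = m ++ [a, b] := by
    rcases l.eq_nil_or_concat with rfl | ⟨l', b, rfl⟩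
    · simp at hxl
    rcases l'.eq_nil_or_concat with rfl | ⟨m, a, rfl⟩
    · simp at hxl hyl
      exact absurd (hxl.trans hyl.symm) hxy
    · exact ⟨m, a, b, by simp⟩
  change List.IsChain _ _ at h
  change List.IsChain _ _
  have hab : a ≠ b := by simpa using (List.isChain_append.1 h).2.1
  rw [dedup_append_pair hab fun c hc => ?_]
  swap
  · have hc' := hmem c (by simp [hc])
    have ha := hmem a (by simp)
    have hb := hmem b (by simp)
    grind
  exact h.append (by simpa using hab) (by simp [hab.symm])

lemma WordRepresents.append_dedup {V : Type*} [DecidableEq V] {G : SimpleGraph V} {w : List V}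
    (hw : WordRepresents G w) : WordRepresents G (w ++ w.dedup) :=
  ⟨fun v => List.mem_append_left _ (hw.1 v), fun x y hxy =>
    (alternates_append_dedup hxy (hw.1 x) (hw.1 y)).trans (hw.2 x y hxy)⟩

/-- The partial map `Option V → V` that deletes `some v` and sends `none` to `v`. -/
def swapErase {V : Type*} [DecidableEq V] (v : V) : Option V → Option V
  | none => some v
  | some z => if z = v then none else some z

lemma swapErase_injective {V : Type*} [DecidableEq V] (v : V) (a b : Option V) (c : V)
    (ha : swapErase v a = some c) (hb : swapErase v b = some c) : a = b := by
  cases a <;> cases b <;> grind [swapErase]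

/-- If a word over `Option V` yields the same representing word for `G` when either of the twins
`none` and `some v` is deleted, then it represents the graph with the vertex `v` duplicated. -/
lemma WordRepresents.of_filterMap_eq {V : Type*} [DecidableEq V] {G : SimpleGraph V}
    {G' : SimpleGraph (Option V)} {v : V} {p : Prop} {w : List V} {W : List (Option V)}
    (hw : WordRepresents G w)
    (hold : ∀ x y : V, G'.Adj (some x) (some y) ↔ G.Adj x y)
    (hnew : ∀ u : V, G'.Adj none (some u) ↔ (G.Adj v u ∨ (u = v ∧ p)))
    (hid : W.filterMap id = w) (hswap : W.filterMap (swapErase v) = w)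
    (htwin : Alternates W (some v) none ↔ p) : WordRepresents G' W := by
  have hnone (u : V) : Alternates W none (some u) ↔ G'.Adj none (some u) := by
    rw [hnew]
    by_cases hu : u = v
    · subst hu
      simpa [alternates_comm] using htwin
    · rw [← alternates_filterMap (swapErase_injective v) (a := none) (b := some u)
        (x := v) (y := u) rfl (by simp [swapErase, hu]), hswap, hw.2 v u (Ne.symm hu)]
      simp [hu]
  refine ⟨?_, ?_⟩
  · rintro (_ | x)
    · have hv := hw.1 v
      rw [← hswap, List.mem_filterMap] at hv
      obtain ⟨a, ha, hav⟩ := hv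
      rwa [swapErase_injective v a none v hav rfl] at ha
    · have hx := hw.1 x
      rw [← hid] at hx
      simpa using hx
  · rintro (_ | x) (_ | y) hxy
    · exact absurd rfl hxy
    · exact hnone y
    · rw [alternates_comm, G'.adj_comm]
      exact hnone x
    · rw [← alternates_filterMap (e := id) (fun _ _ _ h h' => h.trans h'.symm) (a := some x) (b := some y) rfl rfl, hid,
        hold]
      exact hw.2 x y (by simpa using hxy)

/-- Replace every occurrence of `v` in a word by the block `B`. -/
def expandAt {V : Type*} [DecidableEq V] (v : V) (B : List (Option V)) (w : List V) :
    List (Option V) :=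
  w.flatMap fun z => if z = v then B else [some z]

section expandAt

variable {V : Type*} [DecidableEq V] {v : V}

lemma expandAt_cons (B : List (Option V)) (a : V) (w : List V) :
    expandAt v B (a :: w) = (if a = v then B else [some a]) ++ expandAt v B w := rfl

lemma expandAt_filterMap {B : List (Option V)} {e : Option V → Option V}
    (hB : B.filterMap e = [v]) (he : ∀ z ≠ v, e (some z) = some z) (w : List V) :
    (expandAt v B w).filterMap e = w := by
  induction w with
  | nil => rfl
  | cons a w ih =>
    rw [expandAt_cons, List.filterMap_append, ih]
    by_cases ha : a = v
    · simp [ha, hB]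
    · simp [ha, he a ha]

lemma expandAt_filter {B : List (Option V)}
    (hB : ∀ z ∈ B, z = some v ∨ z = none) (w : List V) :
    (expandAt v B w).filter (fun z => decide (z = some v ∨ z = none)) =
      (List.replicate (w.count v) B).flatten := by
  induction w with
  | nil => rfl
  | cons a w ih =>
    rw [expandAt_cons, List.filter_append, ih]
    by_cases ha : a = v
    · have : B.filter (fun z => decide (z = some v ∨ z = none)) = B :=
        List.filter_eq_self.2 (by simpa using hB)
      simp only [ha, if_true, this, List.count_cons_self, List.replicate_succ,
        List.flatten_cons]
    · simp [ha]

end expandAt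

lemma isChain_flatten_replicate_pair {α : Type*} {a b : α} (hab : a ≠ b) (n : ℕ) :
    (List.replicate n [a, b]).flatten.IsChain (· ≠ ·) := by
  induction n with
  | zero => simp
  | succ n ih =>
    rw [List.replicate_succ, List.flatten_cons]
    refine List.IsChain.append (by simpa using hab) ih ?_
    cases n <;> simp [List.replicate_succ, hab.symm]

/-- Duplicating a vertex `v` of a finite split graph (adding a new vertex `none` whose
neighborhood is exactly `N(v)`, adjacent to `v` itself precisely when `v` belongs to the
clique `K`) preserves and reflects word-representability. The new graph `G'` lives on
`Option V`, with `none` the new vertex. -/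
theorem stmt8 {V : Type*} [Fintype V] [DecidableEq V] (G : SimpleGraph V)
    (K E : Finset V) (hdisj : Disjoint K E) (hunion : K ∪ E = Finset.univ)
    (hK : G.IsClique (K : Set V)) (hE : ∀ u ∈ E, ∀ v ∈ E, ¬ G.Adj u v)
    (v : V) (G' : SimpleGraph (Option V))
    (hold : ∀ x y : V, G'.Adj (some x) (some y) ↔ G.Adj x y)
    (hnew : ∀ u : V, G'.Adj none (some u) ↔ (G.Adj v u ∨ (u = v ∧ v ∈ K))) :
    WordRepresentable G ↔ WordRepresentable G' := by
  constructor
  · rintro ⟨w, hw⟩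
    by_cases hv : v ∈ K
    · refine ⟨expandAt v [some v, none] w,
        hw.of_filterMap_eq hold hnew (expandAt_filterMap rfl (by simp) w)
          (expandAt_filterMap (by simp [swapErase]) (by simp +contextual [swapErase]) w) ?_⟩
      simp only [hv, iff_true, Alternates]
      rw [expandAt_filter (by simp)]
      exact isChain_flatten_replicate_pair (by simp) _
    · refine ⟨expandAt v [some v, none] w ++ expandAt v [none, some v] w.dedup,
        hw.append_dedup.of_filterMap_eq hold hnew ?_ ?_ ?_⟩
      · rw [List.filterMap_append, expandAt_filterMap rfl (by simp),
          expandAt_filterMap rfl (by simp)]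
      · rw [List.filterMap_append,
          expandAt_filterMap (by simp [swapErase]) (by simp +contextual [swapErase]),
          expandAt_filterMap (by simp [swapErase]) (by simp +contextual [swapErase])]
      have hpos {l : List V} (hl : v ∈ l) : ∃ n, l.count v = n + 1 :=
        Nat.exists_eq_succ_of_ne_zero (List.count_pos_iff.2 hl).ne'
      obtain ⟨m, hm⟩ := hpos (hw.1 v)
      obtain ⟨n, hn⟩ := hpos (List.mem_dedup.2 (hw.1 v))
      simp only [hv, iff_false, Alternates, List.filter_append]
      rw [expandAt_filter (by simp), expandAt_filter (by simp), hm, hn,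
        List.replicate_succ', List.replicate_succ]
      intro h
      have h' := List.isChain_append.1 h
      simp at h'
  · rintro ⟨w, hw⟩
    refine ⟨w.filterMap id, fun x => by simpa using hw.1 (some x), fun x y hxy => ?_⟩
    rw [alternates_filterMap (e := id) (fun _ _ _ h h' => h.trans h'.symm)
      (a := some x) (b := some y) rfl rfl, ← hold]
    exact hw.2 _ _ (by simpa using hxy)
end

section
/- Let D₁ be the split graph with vertex set {1,2,3,4,5,6} ∪ {a,b,c,d}, in which {1,2,3,4,5,6} induces a complete graph, {a,b,c,d} is an independent set, and the remaining edges are exactly: a adjacent to 1, 3, 5; b adjacent to 1, 2; c adjacent to 3, 4; d adjacent to 5, 6. Then the induced subgraph of D₁ obtained by deleting the clique vertex 1 is word-representable. -/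
/-- Neighborhoods in the clique `{1,…,6}` (represented by `Fin 6`, with vertex `i+1`
represented by `i`) of the independent vertices `a, b, c, d` (represented by `Fin 4`):
`a` is adjacent to `1,3,5`; `b` to `1,2`; `c` to `3,4`; `d` to `5,6`. -/
def D1nbr : Fin 4 → Finset (Fin 6)
  | 0 => {0, 2, 4}
  | 1 => {0, 1}
  | 2 => {2, 3}
  | 3 => {4, 5}

/-- The split graph `D₁`: the clique `{1,…,6}` (as `Fin 6`), the independent set
`{a,b,c,d}` (as `Fin 4`), and edges between them given by `D1nbr`. -/
def D1 : SimpleGraph (Fin 6 ⊕ Fin 4) :=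
  SimpleGraph.fromRel fun u v =>
    match u, v with
    | Sum.inl _, Sum.inl _ => True
    | Sum.inl i, Sum.inr a => i ∈ D1nbr a
    | _, _ => False

instance : DecidableRel D1.Adj
  | .inl i, .inl j => decidable_of_iff (i ≠ j) (by simp [D1])
  | .inl i, .inr a => decidable_of_iff (i ∈ D1nbr a) (by simp [D1])
  | .inr a, .inl i => decidable_of_iff (i ∈ D1nbr a) (by simp [D1])
  | .inr _, .inr _ => .isFalse (by simp [D1])

instance {V : Type*} [DecidableEq V] (w : List V) (x y : V) : Decidable (Alternates w x y) :=
  inferInstanceAs (Decidable (List.IsChain _ _))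

/-- The word `c43cd56db2b4a35a62`. In it the clique `4, 3, 5, 6, 2` is listed twice in the same
order, and each independent vertex occurs twice, just around its neighbours, which are
consecutive in that order. -/
def deletedD1Word : List {v : Fin 6 ⊕ Fin 4 | v ≠ Sum.inl 0} :=
  [⟨.inr 2, by decide⟩, ⟨.inl 3, by decide⟩, ⟨.inl 2, by decide⟩, ⟨.inr 2, by decide⟩,
    ⟨.inr 3, by decide⟩, ⟨.inl 4, by decide⟩, ⟨.inl 5, by decide⟩, ⟨.inr 3, by decide⟩,
    ⟨.inr 1, by decide⟩, ⟨.inl 1, by decide⟩, ⟨.inr 1, by decide⟩, ⟨.inl 3, by decide⟩,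
    ⟨.inr 0, by decide⟩, ⟨.inl 2, by decide⟩, ⟨.inl 4, by decide⟩, ⟨.inr 0, by decide⟩,
    ⟨.inl 5, by decide⟩, ⟨.inl 1, by decide⟩]

/-- Deleting the vertex `1` (the clique vertex represented by `Sum.inl 0`) from `D₁` yields a word-representable graph. -/
theorem stmt13 :
    WordRepresentable (D1.induce {v : Fin 6 ⊕ Fin 4 | v ≠ Sum.inl 0}) := by
  refine ⟨deletedD1Word, ?_, ?_⟩
  · rintro ⟨v, hv⟩
    simp only [deletedD1Word, List.mem_cons, Subtype.mk.injEq, List.not_mem_nil]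
    change v ≠ Sum.inl 0 at hv
    revert v
    decide
  · rintro ⟨x, hx⟩ ⟨y, hy⟩
    rw [SimpleGraph.comap_adj]
    revert x y
    decide +kernel
end
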